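/- Uselessness of side-information in the lossless case: if the reproduction distortion d is the Hamming distortion on 𝒳̂ = 𝒳, then for D = 0 and every E > 0, R_a(0|E) = H(X), the Shannon entropy of the source. -/

import Mathlib

open scoped BigOperators

noncomputable section

namespace UWZ

/-- real-valued indicator of a proposition. -/
def ind (p : Prop) : ℝ := @ite ℝ p (Classical.propDecidable p) 1 0

/-- `P` is a probability distribution on the finite type `A`. -/
def IsDist {A : Type*} [Fintype A] (P : A → ℝ) : Prop :=
  (∀ a, 0 ≤ P a) ∧ ∑ a, P a = 1

/-- `W` is a channel from `A` to `B`. -/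
def IsChannel {A B : Type*} [Fintype A] [Fintype B] (W : A → B → ℝ) : Prop :=
  ∀ a, IsDist (W a)

/-- the `n`-fold i.i.d. extension of `P`. -/
def iid {A : Type*} (P : A → ℝ) (n : ℕ) (xs : Fin n → A) : ℝ := ∏ t, P (xs t)

/-- the memoryless (`n`-fold i.i.d.) extension of a channel. -/
def memoryless {A B : Type*} (W : A → B → ℝ) (n : ℕ)
    (xs : Fin n → A) (ys : Fin n → B) : ℝ :=
  ∏ t, W (xs t) (ys t)

/-- the additive (per-letter, normalized) extension of a distortion measure. -/
def dseq {A B : Type*} (d : A → B → ℝ) (n : ℕ) (xs : Fin n → A) (ys : Fin n → B) : ℝ :=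
  (∑ t, d (xs t) (ys t)) / n

/-- Shannon entropy (in bits). -/
def ent {A : Type*} [Fintype A] (P : A → ℝ) : ℝ := -∑ a, P a * Real.logb 2 (P a)

/-- mutual information of a joint distribution on `A × B` (in bits). -/
def mutInf {A B : Type*} [Fintype A] [Fintype B] (J : A × B → ℝ) : ℝ :=
  ent (fun a => ∑ b, J (a, b)) + ent (fun b => ∑ a, J (a, b)) - ent J

section WZ

variable {X Y Xh : Type*} [Fintype X] [Fintype Y] [Fintype Xh] [DecidableEq Y]

/-- expected per-letter side-information distortion `e(P,W)` of channel `W`. -/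
def eDist (P : X → ℝ) (e : X → Y → ℝ) (W : X → Y → ℝ) : ℝ :=
  ∑ x, ∑ y, P x * W x y * e x y

/-- the class `𝒲₁(E)` of single-letter channels. -/
def W1 (P : X → ℝ) (e : X → Y → ℝ) (E : ℝ) : Set (X → Y → ℝ) :=
  {W | IsChannel W ∧ eDist P e W ≤ E}

/-- `d(V,W)`: expected reproduction distortion for a test channel `V` whose output
alphabet `𝒰` is the set of functions from `Y` to `Xh`. -/
def dVW (P : X → ℝ) (d : X → Xh → ℝ) (V : X → (Y → Xh) → ℝ) (W : X → Y → ℝ) : ℝ :=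
  ∑ u : Y → Xh, ∑ x, ∑ y, P x * V x u * W x y * d x (u y)

/-- `φ(V,W) = I(U;X) − I(U;Y)` under the joint law `P_X(x)V(u|x)W(y|x)`. -/
def phi (P : X → ℝ) (V : X → (Y → Xh) → ℝ) (W : X → Y → ℝ) : ℝ :=
  mutInf (fun p : (Y → Xh) × X => P p.2 * V p.2 p.1) -
    mutInf (fun p : (Y → Xh) × Y => ∑ x, P x * V x p.1 * W x p.2)

/-- `𝒱(W,D)`. -/
def Vset (P : X → ℝ) (d : X → Xh → ℝ) (W : X → Y → ℝ) (D : ℝ) :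
    Set (X → (Y → Xh) → ℝ) :=
  {V | IsChannel V ∧ dVW P d V W ≤ D}

/-- `𝒱(E,D)`. -/
def Vrob (P : X → ℝ) (e : X → Y → ℝ) (d : X → Xh → ℝ) (E D : ℝ) :
    Set (X → (Y → Xh) → ℝ) :=
  {V | IsChannel V ∧ ∀ W ∈ W1 P e E, dVW P d V W ≤ D}

/-- the Wyner–Ziv rate-distortion function `R_WZ(D|W)`. -/
def RWZ (P : X → ℝ) (d : X → Xh → ℝ) (D : ℝ) (W : X → Y → ℝ) : ℝ :=
  sInf ((fun V => phi P V W) '' Vset P d W D)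

/-- the pseudo rate-distortion function `R̃_WZ(D|W,E)`. -/
def RWZt (P : X → ℝ) (e : X → Y → ℝ) (d : X → Xh → ℝ) (D E : ℝ) (W : X → Y → ℝ) : ℝ :=
  sInf ((fun V => phi P V W) '' Vrob P e d E D)

end WZ

/-- a (possibly stochastic) Wyner–Ziv code of blocklength `n`:
a stochastic encoder `enc : 𝒳ⁿ → ℳ` and a decoder `dec : ℳ × 𝒴ⁿ → 𝒳̂ⁿ`. -/
structure Code (X Y Xh : Type*) [Fintype X] (n : ℕ) where
  M : ℕ
  Mpos : 0 < M
  enc : (Fin n → X) → Fin M → ℝ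
  enc_channel : IsChannel enc
  dec : Fin M → (Fin n → Y) → Fin n → Xh

section Codes

variable {X Y Xh : Type*} [Fintype X] [Fintype Y] [Fintype Xh]

/-- expected reproduction distortion of a code over the channel `Wn`. -/
def Code.expDist {n : ℕ} (C : Code X Y Xh n) (P : X → ℝ) (d : X → Xh → ℝ)
    (Wn : (Fin n → X) → (Fin n → Y) → ℝ) : ℝ :=
  ∑ xs, ∑ ys, ∑ m, iid P n xs * Wn xs ys * C.enc xs m * dseq d n xs (C.dec m ys)

/-- probability that the reproduction distortion of a code exceeds `D`, over channel `Wn`. -/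
def Code.excessProb {n : ℕ} (C : Code X Y Xh n) (P : X → ℝ) (d : X → Xh → ℝ)
    (Wn : (Fin n → X) → (Fin n → Y) → ℝ) (D : ℝ) : ℝ :=
  ∑ xs, ∑ ys, ∑ m, iid P n xs * Wn xs ys * C.enc xs m * ind (D < dseq d n xs (C.dec m ys))

/-- a sequence of channels from `X`-sequences to `Y`-sequences. -/
abbrev ChannelSeq (X Y : Type*) := ∀ n : ℕ, (Fin n → X) → (Fin n → Y) → ℝ

/-- probability that the side-information distortion exceeds `E`. -/
def excessSideProb (P : X → ℝ) (e : X → Y → ℝ) {n : ℕ}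
    (Wn : (Fin n → X) → (Fin n → Y) → ℝ) (E : ℝ) : ℝ :=
  ∑ xs, ∑ ys, iid P n xs * Wn xs ys * ind (E < dseq e n xs ys)

/-- expected side-information distortion at blocklength `n`. -/
def avgSideDist (P : X → ℝ) (e : X → Y → ℝ) {n : ℕ}
    (Wn : (Fin n → X) → (Fin n → Y) → ℝ) : ℝ :=
  ∑ xs, ∑ ys, iid P n xs * Wn xs ys * dseq e n xs ys

/-- the maximum distortion constrained class `𝒲_m(E)`. -/
def MaxClass (P : X → ℝ) (e : X → Y → ℝ) (E : ℝ) : Set (ChannelSeq X Y) :=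
  {Wseq | (∀ n, IsChannel (Wseq n)) ∧
    ∀ δ > (0:ℝ), ∃ n0 : ℕ, ∀ n ≥ n0, excessSideProb P e (Wseq n) E ≤ δ}

/-- the average distortion constrained class `𝒲_a(E)`. -/
def AvgClass (P : X → ℝ) (e : X → Y → ℝ) (E : ℝ) : Set (ChannelSeq X Y) :=
  {Wseq | (∀ n, IsChannel (Wseq n)) ∧ ∀ n, 1 ≤ n → avgSideDist P e (Wseq n) ≤ E}

/-- `R` is an achievable rate at distortion level `D`, universally for the class `WC`
of channel sequences. -/
def Achievable (P : X → ℝ) (d : X → Xh → ℝ) (WC : Set (ChannelSeq X Y)) (D R : ℝ) : Prop :=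
  ∀ ε > (0:ℝ), ∃ n0 : ℕ, ∃ C : ∀ n, Code X Y Xh n, ∀ n ≥ n0,
    Real.logb 2 ((C n).M : ℝ) / (n : ℝ) ≤ R + ε ∧
    ∀ Wseq ∈ WC, (C n).expDist P d (Wseq n) ≤ D + ε

/-- the rate-distortion function `R_m(D|E)` of the maximum distortion constrained class. -/
def Rm (P : X → ℝ) (e : X → Y → ℝ) (d : X → Xh → ℝ) (D E : ℝ) : ℝ :=
  sInf {R | Achievable P d (MaxClass P e E) D R}

/-- the rate-distortion function `R_a(D|E)` of the average distortion constrained class. -/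
def Ra (P : X → ℝ) (e : X → Y → ℝ) (d : X → Xh → ℝ) (D E : ℝ) : ℝ :=
  sInf {R | Achievable P d (AvgClass P e E) D R}

end Codes

/-- a Heegard–Berger code: one encoder and two decoders. -/
structure HBCode (X Y Xh : Type*) (n : ℕ) where
  M : ℕ
  Mpos : 0 < M
  enc : (Fin n → X) → Fin M
  dec1 : Fin M → (Fin n → Y) → Fin n → Xh
  dec2 : Fin M → (Fin n → Y) → Fin n → Xh

section HB

variable {X Y Xh : Type*} [Fintype X] [Fintype Y] [Fintype Xh]

/-- expected distortion of one branch of a Heegard–Berger code over the memoryless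
extension of the single-letter channel `W`. -/
def hbExpDist {n M : ℕ} (P : X → ℝ) (d : X → Xh → ℝ) (W : X → Y → ℝ)
    (enc : (Fin n → X) → Fin M) (dec : Fin M → (Fin n → Y) → Fin n → Xh) : ℝ :=
  ∑ xs, ∑ ys, iid P n xs * memoryless W n xs ys * dseq d n xs (dec (enc xs) ys)

/-- achievability for the Heegard–Berger problem with side-information channels `W₁, W₂`. -/
def HBAchievable (P : X → ℝ) (d : X → Xh → ℝ) (W₁ W₂ : X → Y → ℝ) (D₁ D₂ R : ℝ) : Prop :=
  ∀ ε > (0:ℝ), ∃ n0 : ℕ, ∃ C : ∀ n, HBCode X Y Xh n, ∀ n ≥ n0,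
    Real.logb 2 ((C n).M : ℝ) / (n : ℝ) ≤ R + ε ∧
    hbExpDist P d W₁ (C n).enc (C n).dec1 ≤ D₁ + ε ∧
    hbExpDist P d W₂ (C n).enc (C n).dec2 ≤ D₂ + ε

/-- the Heegard–Berger rate-distortion function `R_HB(D₁,D₂|W₁,W₂)`. -/
def RHB (P : X → ℝ) (d : X → Xh → ℝ) (W₁ W₂ : X → Y → ℝ) (D₁ D₂ : ℝ) : ℝ :=
  sInf {R | HBAchievable P d W₁ W₂ D₁ D₂ R}

end HB

/-- the classical (no side-information) rate-distortion function `R(D)`. -/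
def RD {X Xh : Type*} [Fintype X] [Fintype Xh] (P : X → ℝ) (d : X → Xh → ℝ) (D : ℝ) : ℝ :=
  sInf ((fun Q : X → Xh → ℝ => mutInf fun p : X × Xh => P p.1 * Q p.1 p.2) ''
    {Q | IsChannel Q ∧ (∑ x, ∑ xh, P x * Q x xh * d x xh) ≤ D})

section Types

variable {X Y : Type*} [Fintype X] [Fintype Y] [DecidableEq X] [DecidableEq Y]

/-- the empirical distribution (type) `P_{x^n}` of a sequence. -/
def empDist {n : ℕ} (xs : Fin n → X) (a : X) : ℝ :=
  ((Finset.univ.filter fun t => xs t = a).card : ℝ) / n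

/-- the joint empirical distribution (joint type) of a pair of sequences. -/
def empJoint {n : ℕ} (xs : Fin n → X) (ys : Fin n → Y) (p : X × Y) : ℝ :=
  ((Finset.univ.filter fun t => xs t = p.1 ∧ ys t = p.2).card : ℝ) / n

/-- `x^n` is `P`-typical with constant `δ`. -/
def isTypical {n : ℕ} (P : X → ℝ) (δ : ℝ) (xs : Fin n → X) : Prop :=
  (∀ a, |empDist xs a - P a| ≤ δ) ∧ ∀ t, P (xs t) ≠ 0

/-- `y^n` lies in the `W`-shell `T_W(x^n)` of `x^n`. -/
def inShell {n : ℕ} (xs : Fin n → X) (ys : Fin n → Y) (W : X → Y → ℝ) : Prop :=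
  ∀ a b, empJoint xs ys (a, b) = empDist xs a * W a b

/-- cardinality of the `W`-shell of `x^n`. -/
def shellCard {n : ℕ} (xs : Fin n → X) (W : X → Y → ℝ) : ℕ :=
  Set.ncard {ys : Fin n → Y | inShell xs ys W}

end Types

/-- `W` is a conditional type with denominator `n` (all entries are multiples of `1/n`). -/
def isCondType {X Y : Type*} (n : ℕ) (W : X → Y → ℝ) : Prop :=
  ∀ x y, ∃ k : ℕ, W x y = (k : ℝ) / n

section Perm

variable {X Y Xh : Type*} [Fintype X] [Fintype Y] [Fintype Xh]

/-- probability, under the permuted source/side-information pair, that the reproduction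
distortion of the code `C` exceeds `D`. -/
def permExcess {n : ℕ} (Pxy : (Fin n → X) × (Fin n → Y) → ℝ) (C : Code X Y Xh n)
    (d : X → Xh → ℝ) (D : ℝ) (π : Equiv.Perm (Fin n)) : ℝ :=
  ∑ p : (Fin n → X) × (Fin n → Y), ∑ m,
    Pxy p * C.enc (p.1 ∘ π) m * ind (D < dseq d n (p.1 ∘ π) (C.dec m (p.2 ∘ π)))

end Perm

open Filter Topology

lemma iid_nonneg {A : Type*} [Fintype A] {P : A → ℝ} (hP : IsDist P) (n : ℕ) (xs : Fin n → A) :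
    0 ≤ iid P n xs := Finset.prod_nonneg fun _ _ => hP.1 _

lemma prod_sum_one {A : Type*} [Fintype A] (n : ℕ) (Q : Fin n → A → ℝ)
    (hQ : ∀ t, ∑ a, Q t a = 1) : ∑ xs : Fin n → A, ∏ t, Q t (xs t) = 1 := by
  classical
  rw [← Fintype.prod_sum]
  simp [hQ]

lemma iid_sum {A : Type*} [Fintype A] {P : A → ℝ} (hP : IsDist P) (n : ℕ) :
    ∑ xs, iid P n xs = 1 := prod_sum_one n (fun _ => P) (fun _ => hP.2)

lemma sum_cons {A : Type*} [Fintype A] (n : ℕ) (F : (Fin (n+1) → A) → ℝ) :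
    ∑ xs, F xs = ∑ a, ∑ ys : Fin n → A, F (Fin.cons a ys) := by
  rw [← (Fin.consEquiv (fun _ => A)).sum_comp, Fintype.sum_prod_type]
  rfl

lemma iid_cons {A : Type*} (P : A → ℝ) (n : ℕ) (a : A) (ys : Fin n → A) :
    iid P (n+1) (Fin.cons a ys) = P a * iid P n ys := by
  simp [iid, Fin.prod_univ_succ]

lemma iid_first {A : Type*} [Fintype A] {P : A → ℝ} (hP : IsDist P) (f : A → ℝ) (n : ℕ) :
    ∑ xs, iid P n xs * ∑ t, f (xs t) = n * ∑ a, P a * f a := by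
  induction n with
  | zero => simp
  | succ n ih =>
    rw [sum_cons]
    have h : ∀ a, ∑ ys : Fin n → A, iid P (n+1) (Fin.cons a ys) *
        ∑ t, f ((Fin.cons a ys : Fin (n+1) → A) t) =
        P a * f a + P a * (n * ∑ a, P a * f a) := by
      intro a
      rw [← ih]
      simp only [iid_cons, Fin.sum_univ_succ, Fin.cons_zero, Fin.cons_succ]
      have : ∀ ys : Fin n → A, P a * iid P n ys * (f a + ∑ i, f (ys i)) =
        P a * f a * iid P n ys + P a * (iid P n ys * ∑ i, f (ys i)) := fun ys => by ring
      simp only [this, Finset.sum_add_distrib, ← Finset.mul_sum, iid_sum hP, mul_one]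
    simp only [h, Finset.sum_add_distrib, ← Finset.sum_mul, hP.2]
    push_cast; ring

lemma iid_second {A : Type*} [Fintype A] {P : A → ℝ} (hP : IsDist P) (f : A → ℝ)
    (hf : ∑ a, P a * f a = 0) (n : ℕ) :
    ∑ xs, iid P n xs * (∑ t, f (xs t))^2 = n * ∑ a, P a * f a ^ 2 := by
  induction n with
  | zero => simp
  | succ n ih =>
    rw [sum_cons]
    have h : ∀ a, ∑ ys : Fin n → A, iid P (n+1) (Fin.cons a ys) *
        (∑ t, f ((Fin.cons a ys : Fin (n+1) → A) t))^2 =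
        P a * f a ^ 2 + P a * (n * ∑ a, P a * f a ^ 2) := by
      intro a
      rw [← ih]
      simp only [iid_cons, Fin.sum_univ_succ, Fin.cons_zero, Fin.cons_succ]
      have : ∀ ys : Fin n → A, P a * iid P n ys * (f a + ∑ i, f (ys i))^2 =
        P a * f a ^ 2 * iid P n ys + 2 * P a * f a * (iid P n ys * ∑ i, f (ys i))
         + P a * (iid P n ys * (∑ i, f (ys i))^2) := fun ys => by ring
      simp only [this, Finset.sum_add_distrib, ← Finset.mul_sum, iid_sum hP, mul_one,
        iid_first hP, hf]
      ring
    simp only [h, Finset.sum_add_distrib, ← Finset.sum_mul, hP.2]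
    push_cast; ring

lemma iid_log {A : Type*} (P : A → ℝ) (n : ℕ) (xs : Fin n → A) :
    iid P n xs * Real.log (iid P n xs) = iid P n xs * ∑ t, Real.log (P (xs t)) := by
  by_cases h : iid P n xs = 0
  · simp [h]
  · congr 1
    unfold iid at h ⊢
    rw [Real.log_prod]
    intro t ht h0
    exact h (Finset.prod_eq_zero ht h0)

lemma gibbs {A : Type*} [Fintype A] {P Q : A → ℝ} (hP : IsDist P) (hQ : ∑ a, Q a = 1)
    (hQ0 : ∀ a, 0 < Q a) : ∑ a, P a * Real.log (Q a) ≤ ∑ a, P a * Real.log (P a) := by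
  have : ∀ a, P a * Real.log (Q a) - P a * Real.log (P a) ≤ Q a - P a := by
    intro a
    rcases (hP.1 a).eq_or_lt with h | h
    · simp [← h, (hQ0 a).le]
    · have h1 := Real.log_le_sub_one_of_pos (div_pos (hQ0 a) h)
      rw [Real.log_div (hQ0 a).ne' h.ne'] at h1
      have h2 := mul_le_mul_of_nonneg_left h1 h.le
      have h3 : P a * (Q a / P a - 1) = Q a - P a := by field_simp
      linarith
  have h2 := Finset.sum_le_sum (fun a (_ : a ∈ Finset.univ) => this a)
  rw [Finset.sum_sub_distrib, Finset.sum_sub_distrib, hQ, hP.2] at h2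
  linarith

lemma ent_eq {A : Type*} [Fintype A] (P : A → ℝ) :
    ent P * Real.log 2 = -∑ a, P a * Real.log (P a) := by
  have h2 : Real.log 2 ≠ 0 := (Real.log_pos (by norm_num)).ne'
  unfold ent
  rw [neg_mul, Finset.sum_mul]
  congr 1
  refine Finset.sum_congr rfl fun a _ => ?_
  rw [Real.logb]; field_simp

lemma IsDist.le_one {A : Type*} [Fintype A] {P : A → ℝ} (hP : IsDist P) (a : A) : P a ≤ 1 := by
  rw [← hP.2]
  exact Finset.single_le_sum (fun i _ => hP.1 i) (Finset.mem_univ a)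

lemma ent_nonneg {A : Type*} [Fintype A] {P : A → ℝ} (hP : IsDist P) : 0 ≤ ent P := by
  unfold ent
  rw [neg_nonneg]
  refine Finset.sum_nonpos fun a _ => mul_nonpos_of_nonneg_of_nonpos (hP.1 a) ?_
  exact Real.logb_nonpos (by norm_num) (hP.1 a) (hP.le_one a)

/-- Single-shot converse via the Gibbs inequality. -/
lemma converse_core {X : Type*} [Fintype X] [DecidableEq X] [Nonempty X]
    {P : X → ℝ} (hP : IsDist P) (n M : ℕ) (hn : 0 < n) (hM : 0 < M)
    (enc : (Fin n → X) → Fin M → ℝ) (henc : IsChannel enc) (c : Fin M → Fin n → X)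
    (s : ℝ) (hs0 : 0 < s) (hs1 : s < 1) (δ : ℝ)
    (hδ : ∑ xs, ∑ m, iid P n xs * enc xs m *
      dseq (fun x xh : X => if x = xh then (0:ℝ) else 1) n xs (c m) ≤ δ) :
    ent P * Real.log 2 ≤ Real.log M / n - Real.log (1 - s)
      + δ * (- Real.log (s / Fintype.card X)) := by
  have hn' : (0:ℝ) < n := by exact_mod_cast hn
  have hM' : (0:ℝ) < M := by exact_mod_cast hM
  have hK : (0:ℝ) < Fintype.card X := by exact_mod_cast Fintype.card_pos
  have hK1 : (1:ℝ) ≤ Fintype.card X := by exact_mod_cast Fintype.card_pos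
  set K : ℝ := ((Fintype.card X : ℕ) : ℝ) with hKdef
  have hsK : 0 < s / K := div_pos hs0 hK
  set L : ℝ := - Real.log (s / K) with hL
  have hL0 : 0 ≤ L := by
    rw [hL, neg_nonneg]
    exact Real.log_nonpos hsK.le (by rw [div_le_one hK]; linarith)
  let q : X → X → ℝ := fun a x => (if x = a then 1 - s else 0) + s / K
  have hq0 : ∀ a x, 0 < q a x := by
    intro a x
    simp only [q]
    split_ifs <;> linarith
  have hq1 : ∀ a, ∑ x, q a x = 1 := by
    intro a
    simp only [q, Finset.sum_add_distrib, Finset.sum_ite_eq', Finset.mem_univ, if_true,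
      Finset.sum_const, Finset.card_univ, nsmul_eq_mul, ← hKdef]
    field_simp; ring
  have hqlog : ∀ a x, Real.log (1 - s) - (if x = a then (0:ℝ) else 1) * L ≤ Real.log (q a x) := by
    intro a x
    have h1s : Real.log (1 - s) ≤ 0 := Real.log_nonpos (by linarith) (by linarith)
    simp only [q]
    split_ifs with h
    · have := Real.log_le_log (by linarith : (0:ℝ) < 1 - s) (by linarith : 1 - s ≤ 1 - s + s / K)
      linarith
    · rw [zero_add]; simp only [hL]; linarith
  let Qc : Fin M → (Fin n → X) → ℝ := fun m xs => ∏ t, q (c m t) (xs t)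
  have hQc0 : ∀ m xs, 0 < Qc m xs := fun m xs => Finset.prod_pos fun t _ => hq0 _ _
  have hQc1 : ∀ m, ∑ xs, Qc m xs = 1 := fun m => prod_sum_one n (fun t => q (c m t)) fun t => hq1 _
  let Q : (Fin n → X) → ℝ := fun xs => (∑ m, Qc m xs) / M
  have hQ0 : ∀ xs, 0 < Q xs := fun xs =>
    div_pos (Finset.sum_pos (fun m _ => hQc0 m xs) ⟨⟨0, hM⟩, Finset.mem_univ _⟩) hM'
  have hQ1 : ∑ xs, Q xs = 1 := by
    simp only [Q]
    rw [← Finset.sum_div, Finset.sum_comm]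
    simp [hQc1, hM'.ne']
  have hdist : IsDist (iid P n) := ⟨iid_nonneg hP n, iid_sum hP n⟩
  have hg := gibbs hdist hQ1 hQ0
  simp only [iid_log, iid_first hP (fun a => Real.log (P a))] at hg
  have hent := ent_eq P
  have hlow : ∀ xs m, -Real.log M + n * Real.log (1 - s)
      - n * L * dseq (fun x xh : X => if x = xh then (0:ℝ) else 1) n xs (c m)
      ≤ Real.log (Q xs) := by
    intro xs m
    have h1 : Qc m xs / M ≤ Q xs := by
      simp only [Q]
      gcongr
      exact Finset.single_le_sum (f := fun m => Qc m xs) (fun i _ => (hQc0 i xs).le)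
        (Finset.mem_univ m)
    have h2 := Real.log_le_log (div_pos (hQc0 m xs) hM') h1
    rw [Real.log_div (hQc0 m xs).ne' hM'.ne'] at h2
    have h3 : Real.log (Qc m xs) = ∑ t, Real.log (q (c m t) (xs t)) :=
      Real.log_prod fun t _ => (hq0 _ _).ne'
    have h4 := Finset.sum_le_sum (fun t (_ : t ∈ Finset.univ) => hqlog (c m t) (xs t))
    rw [Finset.sum_sub_distrib, ← Finset.sum_mul] at h4
    simp only [Finset.sum_const, Finset.card_univ, Fintype.card_fin, nsmul_eq_mul] at h4
    have h5 : n * L * dseq (fun x xh : X => if x = xh then (0:ℝ) else 1) n xs (c m)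
      = (∑ t, if xs t = c m t then (0:ℝ) else 1) * L := by
      unfold dseq; field_simp
    rw [h5]; linarith
  have hlow2 : ∀ xs, iid P n xs * (-Real.log M + n * Real.log (1 - s))
      - n * L * ∑ m, iid P n xs * enc xs m *
        dseq (fun x xh : X => if x = xh then (0:ℝ) else 1) n xs (c m)
      ≤ iid P n xs * Real.log (Q xs) := by
    intro xs
    have h1 := Finset.sum_le_sum (fun m (_ : m ∈ Finset.univ) =>
      mul_le_mul_of_nonneg_left (hlow xs m)
        (mul_nonneg (iid_nonneg hP n xs) ((henc xs).1 m)))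
    rw [← Finset.sum_mul, ← Finset.mul_sum, (henc xs).2, mul_one] at h1
    refine le_trans (le_of_eq ?_) h1
    have : ∀ m, iid P n xs * enc xs m * (-Real.log M + n * Real.log (1 - s)
      - n * L * dseq (fun x xh : X => if x = xh then (0:ℝ) else 1) n xs (c m))
      = iid P n xs * (-Real.log M + n * Real.log (1 - s)) * enc xs m - n * L * (iid P n xs * enc xs m *
        dseq (fun x xh : X => if x = xh then (0:ℝ) else 1) n xs (c m)) := fun m => by ring
    simp only [this, Finset.sum_sub_distrib, ← Finset.mul_sum, (henc xs).2, mul_one]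
  have h6 := Finset.sum_le_sum (fun xs (_ : xs ∈ Finset.univ) => hlow2 xs)
  rw [Finset.sum_sub_distrib, ← Finset.sum_mul, iid_sum hP, ← Finset.mul_sum] at h6
  have h7 := mul_le_mul_of_nonneg_left hδ (mul_nonneg hn'.le hL0)
  have h8 : n * (ent P * Real.log 2) ≤ Real.log M - n * Real.log (1 - s) + n * L * δ := by
    rw [hent]; linarith
  have h9 : Real.log M / n - Real.log (1 - s) + δ * L =
    (Real.log M - n * Real.log (1 - s) + n * L * δ) / n := by field_simp
  rw [h9, le_div_iff₀ hn']; linarith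

lemma converse {X Y : Type*} [Fintype X] [Fintype Y] [DecidableEq X]
    [Nonempty X] [Nonempty Y]
    (P : X → ℝ) (hP : IsDist P)
    (e : X → Y → ℝ) (he0 : ∀ x y, 0 ≤ e x y) (heZ : ∀ x, ∃ y, e x y = 0)
    (E : ℝ) (hE : 0 < E) (R : ℝ)
    (hR : Achievable P (fun x xh : X => if x = xh then 0 else 1) (AvgClass P e E) 0 R) :
    ent P ≤ R := by
  classical
  choose g hg using heZ
  obtain ⟨y0⟩ := ‹Nonempty Y›
  set em : ℝ := ∑ x, e x y0 with hem
  have hem0 : 0 ≤ em := Finset.sum_nonneg fun x _ => he0 x y0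
  have hele : ∀ x, e x y0 ≤ em := fun x =>
    Finset.single_le_sum (f := fun x => e x y0) (fun i _ => he0 i y0) (Finset.mem_univ x)
  set p : ℝ := min 1 (E / (em + 1)) with hp
  have hp0 : 0 < p := lt_min one_pos (div_pos hE (by linarith))
  have hp1 : p ≤ 1 := min_le_left _ _
  have hpE : p * em ≤ E := by
    have h1 : p ≤ E / (em + 1) := min_le_right _ _
    rw [le_div_iff₀ (by linarith)] at h1
    linarith
  let W : ChannelSeq X Y := fun n xs ys =>
    p * (if ys = (fun _ => y0) then 1 else 0) + (1 - p) * (if ys = g ∘ xs then 1 else 0)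
  have hW0 : ∀ n xs ys, 0 ≤ W n xs ys := by
    intro n xs ys
    have : 0 ≤ 1 - p := by linarith
    simp only [W]
    positivity
  have hWc : W ∈ AvgClass P e E := by
    refine ⟨fun n xs => ⟨hW0 n xs, ?_⟩, fun n hn => ?_⟩
    · simp [W, Finset.sum_add_distrib]
    · have hn' : (0:ℝ) < n := by exact_mod_cast hn
      have h1 : ∀ xs, ∑ ys, iid P n xs * W n xs ys * dseq e n xs ys ≤ iid P n xs * E := by
        intro xs
        have h2 : ∀ ys, iid P n xs * W n xs ys * dseq e n xs ys =
          iid P n xs * p * ((if ys = (fun _ => y0) then dseq e n xs ys else 0))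
          + iid P n xs * (1 - p) * ((if ys = g ∘ xs then dseq e n xs ys else 0)) := by
          intro ys
          simp only [W]
          split_ifs <;> ring
        simp only [h2, Finset.sum_add_distrib, ← Finset.mul_sum, Finset.sum_ite_eq',
          Finset.mem_univ, if_true]
        have h3 : dseq e n xs (g ∘ xs) = 0 := by simp [dseq, hg]
        have h4 : dseq e n xs (fun _ => y0) ≤ em := by
          unfold dseq
          rw [div_le_iff₀ hn']
          calc ∑ t, e (xs t) y0 ≤ ∑ t : Fin n, em := Finset.sum_le_sum fun t _ => hele _
            _ = em * n := by simp [mul_comm]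
        rw [h3, mul_zero, add_zero, mul_assoc]
        refine mul_le_mul_of_nonneg_left ?_ (iid_nonneg hP n xs)
        exact (mul_le_mul_of_nonneg_left h4 hp0.le).trans hpE
      calc avgSideDist P e (W n) ≤ ∑ xs, iid P n xs * E := Finset.sum_le_sum fun xs _ => h1 xs
        _ = E := by rw [← Finset.sum_mul, iid_sum hP, one_mul]
  have hl2 : 0 < Real.log 2 := Real.log_pos (by norm_num)
  have key : ∀ ε > 0, ∀ s, 0 < s → s < 1 → ent P * Real.log 2 ≤ (R + ε) * Real.log 2
      - Real.log (1 - s) + ε / p * (- Real.log (s / Fintype.card X)) := by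
    intro ε hε s hs0 hs1
    obtain ⟨n0, C, hC⟩ := hR ε hε
    obtain ⟨hrate, hdist⟩ := hC (n0 + 1) (by omega)
    have hd := hdist W hWc
    set n := n0 + 1 with hn
    have hcore := converse_core hP n (C n).M (by omega) (C n).Mpos (C n).enc (C n).enc_channel
      (fun m => (C n).dec m (fun _ => y0)) s hs0 hs1 (ε / p) ?_
    · have h1 : Real.log (C n).M / n ≤ (R + ε) * Real.log 2 := by
        have h2 : Real.log (C n).M / n = Real.logb 2 (C n).M / n * Real.log 2 := by
          rw [Real.logb]; field_simp
        rw [h2]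
        exact mul_le_mul_of_nonneg_right hrate hl2.le
      linarith
    · rw [le_div_iff₀ hp0, Finset.sum_mul]
      rw [zero_add] at hd
      refine le_trans (Finset.sum_le_sum fun xs _ => ?_) hd
      have hnn : ∀ ys, 0 ≤ ∑ m, iid P n xs * W n xs ys * (C n).enc xs m *
          dseq (fun x xh : X => if x = xh then (0:ℝ) else 1) n xs ((C n).dec m ys) := by
        intro ys
        refine Finset.sum_nonneg fun m _ => mul_nonneg (mul_nonneg (mul_nonneg
          (iid_nonneg hP n xs) (hW0 n xs ys)) (((C n).enc_channel xs).1 m)) ?_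
        unfold dseq
        positivity
      refine le_trans ?_ (Finset.single_le_sum (fun ys _ => hnn ys)
        (Finset.mem_univ (fun _ => y0)))
      rw [Finset.sum_mul]
      refine Finset.sum_le_sum fun m _ => ?_
      have hWp : p ≤ W n xs (fun _ => y0) := by
        have : 0 ≤ 1 - p := by linarith
        simp only [W, if_true, mul_one]
        have : 0 ≤ (1 - p) * (if (fun _ => y0) = g ∘ xs then (1:ℝ) else 0) := by positivity
        linarith
      have hz : 0 ≤ iid P n xs * (C n).enc xs m * dseq (fun x xh : X => if x = xh then (0:ℝ) else 1) n xs
          ((C n).dec m (fun _ => y0)) := by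
        refine mul_nonneg (mul_nonneg (iid_nonneg hP n xs) (((C n).enc_channel xs).1 m)) ?_
        unfold dseq
        positivity
      have := mul_le_mul_of_nonneg_left hWp hz
      linarith
  have key2 : ∀ s, 0 < s → s < 1 → ent P * Real.log 2 ≤ R * Real.log 2 - Real.log (1 - s) := by
    intro s hs0 hs1
    have ht : Tendsto (fun ε : ℝ => (R + ε) * Real.log 2
      - Real.log (1 - s) + ε / p * (- Real.log (s / Fintype.card X))) (𝓝[>] 0)
      (𝓝 ((R + 0) * Real.log 2
      - Real.log (1 - s) + 0 / p * (- Real.log (s / Fintype.card X)))) := by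
      refine Tendsto.mono_left ?_ nhdsWithin_le_nhds
      refine Continuous.tendsto (f := fun ε : ℝ => (R + ε) * Real.log 2
        - Real.log (1 - s) + ε / p * (- Real.log (s / Fintype.card X))) ?_ 0
      fun_prop
    have := ge_of_tendsto ht (by
      filter_upwards [self_mem_nhdsWithin] with ε hε
      exact key ε hε s hs0 hs1)
    simpa using this
  have key3 : ent P * Real.log 2 ≤ R * Real.log 2 := by
    have ht : Tendsto (fun s : ℝ => R * Real.log 2 - Real.log (1 - s)) (𝓝[>] 0)
      (𝓝 (R * Real.log 2 - Real.log (1 - 0))) := by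
      refine Tendsto.mono_left ?_ nhdsWithin_le_nhds
      have : ContinuousAt (fun s : ℝ => R * Real.log 2 - Real.log (1 - s)) 0 := by
        refine ContinuousAt.sub continuousAt_const (ContinuousAt.log (by fun_prop) (by norm_num))
      exact this
    have := ge_of_tendsto ht (by
      filter_upwards [Ioo_mem_nhdsGT (one_pos : (0:ℝ) < 1)] with s hs
      exact key2 s hs.1 hs.2)
    simpa using this
  exact le_of_mul_le_mul_right key3 hl2


lemma exists_code {X Y : Type*} [Fintype X] [Fintype Y] [DecidableEq X]
    {P : X → ℝ} (hP : IsDist P) (n : ℕ) (T : Finset (Fin n → X)) (hT : T.Nonempty) :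
    ∃ C : Code X Y X n, C.M = T.card ∧ ∀ Wn : (Fin n → X) → (Fin n → Y) → ℝ, IsChannel Wn →
      C.expDist P (fun x xh : X => if x = xh then 0 else 1) Wn
        ≤ ∑ xs, iid P n xs * (if xs ∈ T then 0 else 1) := by
  classical
  obtain ⟨x0, hx0⟩ := hT
  let idx : (Fin n → X) → Fin T.card := fun xs =>
    if h : xs ∈ T then T.equivFin ⟨xs, h⟩ else T.equivFin ⟨x0, hx0⟩
  let C : Code X Y X n :=
    { M := T.card
      Mpos := Finset.card_pos.2 ⟨x0, hx0⟩
      enc := fun xs m => if m = idx xs then 1 else 0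
      enc_channel := fun xs => ⟨fun m => by positivity, by simp⟩
      dec := fun m _ => (T.equivFin.symm m).1 }
  refine ⟨C, rfl, fun Wn hWn => ?_⟩
  unfold Code.expDist
  refine Finset.sum_le_sum fun xs _ => ?_
  have h1 : ∀ ys, ∑ m, iid P n xs * Wn xs ys * C.enc xs m *
      dseq (fun x xh : X => if x = xh then (0:ℝ) else 1) n xs (C.dec m ys)
      ≤ iid P n xs * (if xs ∈ T then 0 else 1) * Wn xs ys := by
    intro ys
    have h2 : ∀ m, iid P n xs * Wn xs ys * C.enc xs m *
      dseq (fun x xh : X => if x = xh then (0:ℝ) else 1) n xs (C.dec m ys) =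
      if m = idx xs then iid P n xs * Wn xs ys *
      dseq (fun x xh : X => if x = xh then (0:ℝ) else 1) n xs (C.dec m ys) else 0 := by
      intro m
      simp only [C]
      split_ifs <;> ring
    have h3 : ∑ m, iid P n xs * Wn xs ys * C.enc xs m *
      dseq (fun x xh : X => if x = xh then (0:ℝ) else 1) n xs (C.dec m ys) =
      iid P n xs * Wn xs ys *
      dseq (fun x xh : X => if x = xh then (0:ℝ) else 1) n xs (C.dec (idx xs) ys) := by
      rw [Finset.sum_congr rfl fun m _ => h2 m]
      exact (Finset.sum_ite_eq' Finset.univ (idx xs) _).trans (if_pos (Finset.mem_univ _))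
    rw [h3]
    have h4 : dseq (fun x xh : X => if x = xh then (0:ℝ) else 1) n xs (C.dec (idx xs) ys)
      ≤ if xs ∈ T then 0 else 1 := by
      split_ifs with h
      · have : C.dec (idx xs) ys = xs := by simp [C, idx, h]
        rw [this]; simp [dseq]
      · unfold dseq
        refine div_le_one_of_le₀ ?_ (by positivity)
        calc _ ≤ ∑ t : Fin n, (1:ℝ) := Finset.sum_le_sum fun t _ => by dsimp only; split_ifs <;> norm_num
          _ = n := by simp
    have := mul_le_mul_of_nonneg_left h4 (mul_nonneg (iid_nonneg hP n xs) ((hWn xs).1 ys))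
    linarith
  refine (Finset.sum_le_sum fun ys _ => h1 ys).trans (le_of_eq ?_)
  rw [← Finset.mul_sum, (hWn xs).2, mul_one]

lemma direct {X Y : Type*} [Fintype X] [Fintype Y] [DecidableEq X] [Nonempty X]
    (P : X → ℝ) (hP : IsDist P) (e : X → Y → ℝ) (E : ℝ) :
    Achievable P (fun x xh : X => if x = xh then 0 else 1) (AvgClass P e E) 0 (ent P) := by
  classical
  intro ε hε
  have hl2 : 0 < Real.log 2 := Real.log_pos (by norm_num)
  set h : ℝ := ent P * Real.log 2 with hh
  set η : ℝ := ε * Real.log 2 with hη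
  have hη0 : 0 < η := mul_pos hε hl2
  let f : X → ℝ := fun x => -Real.log (P x) - h
  have hf : ∑ a, P a * f a = 0 := by
    simp only [f, mul_sub, Finset.sum_sub_distrib, ← Finset.sum_mul, hP.2, mul_neg,
      Finset.sum_neg_distrib]
    rw [hh, ent_eq]; ring
  set v : ℝ := ∑ a, P a * f a ^ 2 with hv
  have hv0 : 0 ≤ v := Finset.sum_nonneg fun a _ => mul_nonneg (hP.1 a) (sq_nonneg _)
  set κ : ℝ := min ε (1/2) with hκ
  have hκ0 : 0 < κ := lt_min hε (by norm_num)
  obtain ⟨n0, hn0⟩ := exists_nat_gt (v / (η ^ 2 * κ))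
  have main : ∀ n, ∃ C : Code X Y X n, n ≥ n0 + 1 →
      Real.logb 2 (C.M : ℝ) / (n : ℝ) ≤ ent P + ε ∧
      ∀ Wseq ∈ AvgClass P e E,
        C.expDist P (fun x xh : X => if x = xh then 0 else 1) (Wseq n) ≤ 0 + ε := by
    intro n
    by_cases hn : n ≥ n0 + 1
    swap
    · obtain ⟨C, -⟩ := exists_code (Y := Y) hP n Finset.univ Finset.univ_nonempty
      exact ⟨C, fun h => absurd h hn⟩
    have hn' : (0:ℝ) < n := by exact_mod_cast (by omega : 0 < n)
    have hnn : (n0:ℝ) ≤ n := by exact_mod_cast (by omega : n0 ≤ n)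
    let T : Finset (Fin n → X) :=
      Finset.univ.filter fun xs => Real.exp (-(n * (h + η))) ≤ iid P n xs
    have hcheb : ∑ xs, iid P n xs * (if xs ∈ T then (0:ℝ) else 1) ≤ κ := by
      have h1 : ∀ xs, iid P n xs * (if xs ∈ T then (0:ℝ) else 1) * (n * η)^2 ≤
          iid P n xs * (∑ t, f (xs t))^2 := by
        intro xs
        split_ifs with hx
        · rw [mul_zero, zero_mul]
          exact mul_nonneg (iid_nonneg hP n xs) (sq_nonneg _)
        · rw [mul_one]
          rcases (iid_nonneg hP n xs).eq_or_lt with h0 | h0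
          · simp [← h0]
          · refine mul_le_mul_of_nonneg_left ?_ h0.le
            have hx' : iid P n xs < Real.exp (-(n * (h + η))) := by
              simpa [T] using hx
            have h2 := (Real.log_lt_iff_lt_exp h0).2 hx'
            have h3 := mul_left_cancel₀ h0.ne' (iid_log P n xs)
            rw [h3] at h2
            have h4 : ∑ t, f (xs t) = -∑ t, Real.log (P (xs t)) - n * h := by
              simp [f, Finset.sum_sub_distrib]
            have h5 : n * η ≤ ∑ t, f (xs t) := by rw [h4]; linarith
            exact pow_le_pow_left₀ (by positivity) h5 2
      have h2 := Finset.sum_le_sum fun xs (_ : xs ∈ Finset.univ) => h1 xs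
      rw [iid_second hP f hf, ← Finset.sum_mul, ← hv] at h2
      have h3 : v < η ^ 2 * κ * n := by
        have := hn0.trans_le hnn
        rw [div_lt_iff₀ (by positivity)] at this
        linarith
      have h4 : n * v ≤ κ * (n * η)^2 := by nlinarith
      exact le_of_mul_le_mul_right (h2.trans h4) (by positivity)
    have hT : T.Nonempty := by
      by_contra hne
      rw [Finset.not_nonempty_iff_eq_empty] at hne
      rw [hne] at hcheb
      simp only [Finset.notMem_empty, if_false, mul_one, iid_sum hP] at hcheb
      have : κ ≤ 1/2 := min_le_right _ _
      linarith
    obtain ⟨C, hM, hC⟩ := exists_code (Y := Y) hP n T hT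
    refine ⟨C, fun _ => ⟨?_, fun Wseq hW => ?_⟩⟩
    · rw [hM]
      have hTpos : (0:ℝ) < T.card := by exact_mod_cast hT.card_pos
      have h1 : T.card * Real.exp (-(n * (h + η))) ≤ 1 := by
        calc (T.card : ℝ) * Real.exp (-(n * (h + η))) = ∑ xs ∈ T, Real.exp (-(n * (h + η))) := by
              simp
          _ ≤ ∑ xs ∈ T, iid P n xs := Finset.sum_le_sum fun xs hx => (Finset.mem_filter.1 hx).2
          _ ≤ ∑ xs, iid P n xs := Finset.sum_le_sum_of_subset_of_nonneg (Finset.subset_univ _)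
              fun xs _ _ => iid_nonneg hP n xs
          _ = 1 := iid_sum hP n
      have h2 := Real.log_nonpos (by positivity) h1
      rw [Real.log_mul hTpos.ne' (Real.exp_pos _).ne', Real.log_exp] at h2
      rw [div_le_iff₀ hn', Real.logb, div_le_iff₀ hl2]
      have : (ent P + ε) * n * Real.log 2 = n * (h + η) := by rw [hh, hη]; ring
      linarith
    · rw [zero_add]
      exact ((hC _ (hW.1 n)).trans hcheb).trans (min_le_left _ _)
  choose C hC using main
  exact ⟨n0 + 1, C, fun n hn => hC n hn⟩

/-- Uselessness of side-information in the lossless case: if the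
reproduction distortion is the Hamming distortion on `𝒳̂ = 𝒳`, then for `D = 0` and every
`E > 0`, `R_a(0|E) = H(X)`. -/
theorem Ra_lossless_eq_entropy
    {X Y : Type*} [Fintype X] [Fintype Y] [DecidableEq X]
    [Nonempty X] [Nonempty Y]
    (P : X → ℝ) (hP : IsDist P)
    (e : X → Y → ℝ) (he0 : ∀ x y, 0 ≤ e x y) (heZ : ∀ x, ∃ y, e x y = 0)
    (E : ℝ) (hE : 0 < E) :
    Ra P e (fun x xh : X => if x = xh then 0 else 1) 0 E = ent P := by
  exact IsLeast.csInf_eq ⟨direct P hP e E, fun R hR => converse P hP e he0 heZ E hE R hR⟩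

end UWZ
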